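/- Existence of tempered Gibbs measures (Corollary). Fix p ∈ [p₀, q) and α ∈ (α_, ᾱ]. For every ξ ∈ L^p(V,w_α) there exists an increasing sequence of finite sets Λ_n exhausting V such that π_{Λ_n}(·|ξ) converges weakly to a probability measure μ on Ω; every such weak limit μ satisfies the DLR equation μ(A) = ∫_Ω π_Λ(A|ω) μ(dω) for all Borel A and all finite Λ, and μ(L^p(V,w_α)) = 1. In particular, 𝒢_{p,α} is non-empty. -/

import Mathlib

open MeasureTheory Real Filter

noncomputable section

variable {V : Type} [Countable V] [DecidableEq V]

/-- The configuration equal to `σ` on `Λ` and to `ξ` off `Λ`. -/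
def comb (Λ : Finset V) (σ : ↥Λ → ℝ) (ξ : V → ℝ) : V → ℝ :=
  fun x => if h : x ∈ Λ then σ ⟨x, h⟩ else ξ x

/-- The relative local Hamiltonian `H_Λ(·|ξ)`, evaluated at the full configuration
`ω = ω_Λ × ξ_{Λᶜ}`: the sum of `W(ω(x),ω(y))` over edges with both ends in `Λ`,
plus the sum of `W(ω(x),ω(y))` over edges with `x ∈ Λ`, `y ∉ Λ`, plus `Σ_{x∈Λ} V(ω(x))`. -/
def ham (G : SimpleGraph V) [∀ v : V, Fintype (G.neighborSet v)]
    (W : ℝ → ℝ → ℝ) (P : ℝ → ℝ) (Λ : Finset V) (ω : V → ℝ) : ℝ :=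
  (∑ x ∈ Λ, ∑ y ∈ G.neighborFinset x ∩ Λ, W (ω x) (ω y)) / 2
    + ∑ x ∈ Λ, ∑ y ∈ G.neighborFinset x \ Λ, W (ω x) (ω y)
    + ∑ x ∈ Λ, P (ω x)

/-- The normalizing constant `Z_Λ(ξ)`. -/
def partZ (G : SimpleGraph V) [∀ v : V, Fintype (G.neighborSet v)]
    (W : ℝ → ℝ → ℝ) (P : ℝ → ℝ) (Λ : Finset V) (ξ : V → ℝ) : ℝ :=
  ∫ σ : ↥Λ → ℝ, Real.exp (- ham G W P Λ (comb Λ σ ξ))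

/-- The local Gibbs specification kernel `π_Λ(·|ξ)`, a measure on `Ω = ℝ^V`. -/
def gibbsKer (G : SimpleGraph V) [∀ v : V, Fintype (G.neighborSet v)]
    (W : ℝ → ℝ → ℝ) (P : ℝ → ℝ) (Λ : Finset V) (ξ : V → ℝ) : Measure (V → ℝ) :=
  (ENNReal.ofReal (partZ G W P Λ ξ))⁻¹ •
    Measure.map (fun σ => comb Λ σ ξ)
      ((volume : Measure (↥Λ → ℝ)).withDensity
        fun σ => ENNReal.ofReal (Real.exp (- ham G W P Λ (comb Λ σ ξ))))

/-- `μ` is a Gibbs measure: a probability measure solving the DLR equation. -/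
def IsGibbsMeasure (G : SimpleGraph V) [∀ v : V, Fintype (G.neighborSet v)]
    (W : ℝ → ℝ → ℝ) (P : ℝ → ℝ) (μ : Measure (V → ℝ)) : Prop :=
  IsProbabilityMeasure μ ∧
    ∀ (Λ : Finset V) (A : Set (V → ℝ)), MeasurableSet A →
      μ A = ∫⁻ ω, gibbsKer G W P Λ ω A ∂μ

/-- The weight `w_α(x) = exp(-α ρ(o,x))`. -/
def wgt (G : SimpleGraph V) (o : V) (α : ℝ) (x : V) : ℝ :=
  Real.exp (-α * (G.dist o x : ℝ))

/-- `‖ω‖_{p,α}^p = Σ_{x∈V} |ω(x)|^p w_α(x)`. -/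
def sNorm (G : SimpleGraph V) (o : V) (p α : ℝ) (ω : V → ℝ) : ℝ :=
  ∑' x : V, |ω x| ^ p * wgt G o α x

/-- The set `L^p(V, w_α)` of tempered configurations. -/
def tempered (G : SimpleGraph V) (o : V) (p α : ℝ) : Set (V → ℝ) :=
  {ω | Summable fun x : V => |ω x| ^ p * wgt G o α x}

/-- The summability `Θ(α,θ) = Σ_x Σ_{y∼x} [n(x)n(y)]^θ w_α(x) < ∞`. -/
def ThetaFin (G : SimpleGraph V) [∀ v : V, Fintype (G.neighborSet v)]
    (o : V) (α θ : ℝ) : Prop :=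
  Summable fun x : V =>
    (∑ y ∈ G.neighborFinset x, ((G.degree x : ℝ) * (G.degree y : ℝ)) ^ θ) * wgt G o α x

set_option linter.unusedSectionVars false

namespace TemperedGibbs

open scoped ENNReal NNReal

section RealInequalities

lemma rpow_le_one_add_rpow {r p t : ℝ} (hr : 0 ≤ r) (hrp : r ≤ p) (ht : 0 ≤ t) :
    t ^ r ≤ 1 + t ^ p := by
  rcases le_total t 1 with h | h
  · linarith [Real.rpow_le_one ht h hr, Real.rpow_nonneg ht p]
  · linarith [Real.rpow_le_rpow_of_exponent_le h hrp]

lemma exists_mul_rpow_le_div_add {r p θ A ε : ℝ} (hr : 0 < r) (hθ : 0 < θ)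
    (hp : r + r / θ ≤ p) (hA : 0 ≤ A) (hε : 0 < ε) :
    ∃ C, 0 ≤ C ∧ ∀ N t : ℝ, 1 ≤ N → 0 ≤ t → A * t ^ r ≤ ε * t ^ p / N + C * N ^ θ := by
  refine ⟨A + A * (A / ε) ^ θ, by positivity, fun N t hN ht => ?_⟩
  have hN0 : 0 < N := by linarith
  have hNθ : 1 ≤ N ^ θ := Real.one_le_rpow hN hθ.le
  have hAε : 0 ≤ (A / ε) ^ θ := by positivity
  have h0 : 0 ≤ ε * t ^ p / N := by positivity
  have h1 : 0 ≤ A * (A / ε) ^ θ * N ^ θ := by positivity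
  rcases le_total t 1 with h | h
  · have : t ^ r ≤ 1 := Real.rpow_le_one ht h hr.le
    nlinarith [mul_le_mul_of_nonneg_left this hA, mul_le_mul_of_nonneg_left hNθ hA]
  by_cases hc : A * t ^ r ≤ ε * t ^ p / N
  · nlinarith [mul_le_mul_of_nonneg_left hNθ hA]
  push Not at hc
  have ht0 : 0 < t := by linarith
  have hpr : t ^ p = t ^ r * t ^ (p - r) := by rw [← Real.rpow_add ht0]; congr 1; ring
  have htr : 0 < t ^ r := Real.rpow_pos_of_pos ht0 r
  have h2 : t ^ (p - r) ≤ A / ε * N := by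
    rw [div_lt_iff₀ hN0, hpr] at hc
    rw [div_mul_eq_mul_div, le_div_iff₀ hε]
    by_contra hcon
    push Not at hcon
    nlinarith [mul_lt_mul_of_pos_left hcon htr]
  have h3 : t ^ (r / θ) ≤ A / ε * N :=
    (Real.rpow_le_rpow_of_exponent_le h (by linarith)).trans h2
  have h4 : t ^ r ≤ (A / ε) ^ θ * N ^ θ := by
    rw [← Real.mul_rpow (by positivity) hN0.le]
    calc t ^ r = (t ^ (r / θ)) ^ θ := by rw [← Real.rpow_mul ht, div_mul_cancel₀ _ hθ.ne']
      _ ≤ _ := Real.rpow_le_rpow (by positivity) h3 hθ.le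
  nlinarith [mul_le_mul_of_nonneg_left h4 hA, mul_le_mul_of_nonneg_left hNθ hA]

lemma exists_mul_rpow_le_mul_rpow_add {p q A a : ℝ} (hp : 0 < p) (hpq : p < q) (hA : 0 ≤ A)
    (ha : 0 < a) : ∃ C, ∀ t : ℝ, 0 ≤ t → A * t ^ p ≤ a * t ^ q + C := by
  refine ⟨A * (A / a) ^ (p / (q - p)), fun t ht => ?_⟩
  have hC : 0 ≤ A * (A / a) ^ (p / (q - p)) := by positivity
  by_cases hc : A * t ^ p ≤ a * t ^ q
  · linarith
  push Not at hc
  have ht0 : 0 < t := by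
    rcases ht.eq_or_lt with h | h
    · rw [← h, Real.zero_rpow hp.ne', Real.zero_rpow (hp.trans hpq).ne'] at hc
      simp at hc
    · exact h
  have hpr : t ^ q = t ^ p * t ^ (q - p) := by rw [← Real.rpow_add ht0]; congr 1; ring
  have htr : 0 < t ^ p := Real.rpow_pos_of_pos ht0 p
  have h2 : t ^ (q - p) ≤ A / a := by
    rw [hpr] at hc
    rw [le_div_iff₀ ha]
    by_contra hcon
    push Not at hcon
    nlinarith [mul_lt_mul_of_pos_left hcon htr]
  have hqp : 0 < q - p := by linarith
  have h4 : t ^ p ≤ (A / a) ^ (p / (q - p)) := by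
    calc t ^ p = (t ^ (q - p)) ^ (p / (q - p)) := by
          rw [← Real.rpow_mul ht, mul_div_cancel₀ _ hqp.ne']
      _ ≤ _ := Real.rpow_le_rpow (by positivity) h2 (by positivity)
  have : 0 ≤ a * t ^ q := by positivity
  nlinarith [mul_le_mul_of_nonneg_left h4 hA]

lemma continuous_abs_rpow {p : ℝ} (hp : 0 < p) : Continuous fun t : ℝ => |t| ^ p :=
  continuous_abs.rpow_const fun _ => Or.inr hp.le

lemma integrable_exp_abs_rpow_sub {p q A a : ℝ} (hp : 0 < p) (hpq : p < q) (hA : 0 ≤ A)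
    (ha : 0 < a) : Integrable fun t : ℝ => Real.exp (A * |t| ^ p - a * |t| ^ q) := by
  have hq : 0 < q := hp.trans hpq
  obtain ⟨C, hC⟩ := exists_mul_rpow_le_mul_rpow_add hp hpq hA (half_pos ha)
  have h1 : Integrable fun t : ℝ => Real.exp (-(a / 2) * |t| ^ q) := by
    refine Integrable.of_integral_ne_zero ?_
    rw [integral_comp_abs (f := fun t => Real.exp (-(a / 2) * t ^ q)),
      integral_exp_neg_mul_rpow hq (half_pos ha)]
    have := Real.Gamma_pos_of_pos (show 0 < 1 / q + 1 by positivity)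
    positivity
  refine (h1.const_mul (Real.exp C)).mono'
    (Continuous.aestronglyMeasurable ?_) (ae_of_all _ fun t => ?_)
  · exact Real.continuous_exp.comp
      (((continuous_abs_rpow hp).const_mul A).sub ((continuous_abs_rpow hq).const_mul a))
  · rw [Real.norm_eq_abs, Real.abs_exp, ← Real.exp_add]
    exact Real.exp_le_exp.2 (by linarith [hC |t| (abs_nonneg t)])

end RealInequalities
section Hamiltonian

variable (G : SimpleGraph V) [∀ v : V, Fintype (G.neighborSet v)] (W : ℝ → ℝ → ℝ) (P : ℝ → ℝ)

lemma comb_apply_of_mem {Λ : Finset V} {x : V} (hx : x ∈ Λ) (σ : ↥Λ → ℝ) (ξ : V → ℝ) :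
    comb Λ σ ξ x = σ ⟨x, hx⟩ := dif_pos hx

lemma comb_apply_of_notMem {Λ : Finset V} {x : V} (hx : x ∉ Λ) (σ : ↥Λ → ℝ) (ξ : V → ℝ) :
    comb Λ σ ξ x = ξ x := dif_neg hx

lemma continuous_comb_right (Λ : Finset V) (σ : ↥Λ → ℝ) : Continuous (comb Λ σ) := by
  refine continuous_pi fun x => ?_
  by_cases h : x ∈ Λ
  · simpa only [comb_apply_of_mem h] using continuous_const
  · simpa only [comb_apply_of_notMem h] using continuous_apply x

lemma measurable_comb_left (Λ : Finset V) (ξ : V → ℝ) :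
    Measurable fun σ : ↥Λ → ℝ => comb Λ σ ξ := measurable_updateFinset

variable {W P} in
lemma continuous_ham (hW : Continuous (Function.uncurry W)) (hP : Continuous P) (Λ : Finset V) :
    Continuous (ham G W P Λ) := by
  have h : ∀ x y : V, Continuous fun ω : V → ℝ => W (ω x) (ω y) := fun x y =>
    hW.comp (f := fun ω : V → ℝ => (ω x, ω y)) (by fun_prop)
  unfold ham
  fun_prop

/-- The part of `ham G W P Λ` not involving the coordinates in `Δ`. -/
def hamRest (Δ Λ : Finset V) (ω : V → ℝ) : ℝ :=
  (∑ x ∈ Λ \ Δ, ∑ y ∈ G.neighborFinset x ∩ (Λ \ Δ), W (ω x) (ω y)) / 2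
    + ∑ x ∈ Λ \ Δ, ∑ y ∈ G.neighborFinset x \ Λ, W (ω x) (ω y)
    + ∑ x ∈ Λ \ Δ, P (ω x)

variable {W} in
lemma ham_eq_ham_add_hamRest (hsymm : ∀ u v, W u v = W v u) {Δ Λ : Finset V} (hΔ : Δ ⊆ Λ)
    (ω : V → ℝ) : ham G W P Λ ω = ham G W P Δ ω + hamRest G W P Δ Λ ω := by
  have hsplit : ∀ f : V → ℝ, ∑ x ∈ Λ, f x = ∑ x ∈ Δ, f x + ∑ x ∈ Λ \ Δ, f x := fun f => by
    rw [add_comm, Finset.sum_sdiff hΔ]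
  have hin : ∀ (x : V) (f : V → ℝ), ∑ y ∈ G.neighborFinset x ∩ Λ, f y =
      ∑ y ∈ G.neighborFinset x ∩ Δ, f y + ∑ y ∈ G.neighborFinset x ∩ (Λ \ Δ), f y := by
    intro x f
    rw [← Finset.sum_union]
    · rw [← Finset.inter_union_distrib_left, Finset.union_sdiff_of_subset hΔ]
    · exact Finset.disjoint_of_subset_left Finset.inter_subset_right
        (Finset.disjoint_of_subset_right Finset.inter_subset_right Finset.disjoint_sdiff)
  have hout : ∀ (x : V) (f : V → ℝ), ∑ y ∈ G.neighborFinset x \ Δ, f y =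
      ∑ y ∈ G.neighborFinset x ∩ (Λ \ Δ), f y + ∑ y ∈ G.neighborFinset x \ Λ, f y := by
    intro x f
    rw [← Finset.sum_union]
    · congr 1
      ext y
      simp only [Finset.mem_sdiff, Finset.mem_union, Finset.mem_inter]
      have := @hΔ y
      tauto
    · rw [Finset.disjoint_left]
      simp only [Finset.mem_sdiff, Finset.mem_inter]
      tauto
  have hcross : ∑ x ∈ Λ \ Δ, ∑ y ∈ G.neighborFinset x ∩ Δ, W (ω x) (ω y) =
      ∑ x ∈ Δ, ∑ y ∈ G.neighborFinset x ∩ (Λ \ Δ), W (ω x) (ω y) := by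
    rw [Finset.sum_comm' (t' := Δ) (s' := fun y => G.neighborFinset y ∩ (Λ \ Δ))]
    · exact Finset.sum_congr rfl fun x _ => Finset.sum_congr rfl fun y _ => hsymm _ _
    · intro x y
      simp only [Finset.mem_sdiff, Finset.mem_inter, SimpleGraph.mem_neighborFinset, G.adj_comm x y]
      tauto
  unfold ham hamRest
  rw [hsplit, hsplit, hsplit]
  simp only [hin, hout, Finset.sum_add_distrib, hcross]
  ring

lemma hamRest_congr {Δ Λ : Finset V} (hΔ : Δ ⊆ Λ) {ω ω' : V → ℝ} (h : ∀ x ∉ Δ, ω x = ω' x) :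
    hamRest G W P Δ Λ ω = hamRest G W P Δ Λ ω' := by
  have h1 : ∀ x ∈ Λ \ Δ, ω x = ω' x := fun x hx => h x (Finset.mem_sdiff.1 hx).2
  unfold hamRest
  congr 1
  · congr 1
    · congr 1
      refine Finset.sum_congr rfl fun x hx => Finset.sum_congr rfl fun y hy => ?_
      rw [h1 x hx, h1 y (Finset.mem_inter.1 hy).2]
    · refine Finset.sum_congr rfl fun x hx => Finset.sum_congr rfl fun y hy => ?_
      rw [h1 x hx, h y fun hyΔ => (Finset.mem_sdiff.1 hy).2 (hΔ hyΔ)]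
  · exact Finset.sum_congr rfl fun x hx => by rw [h1 x hx]

lemma ham_singleton_update (x : V) (ξ : V → ℝ) (t : ℝ) :
    ham G W P {x} (Function.update ξ x t) = ∑ y ∈ G.neighborFinset x, W t (ξ y) + P t := by
  have h1 : G.neighborFinset x ∩ {x} = ∅ := by ext; aesop
  have h2 : G.neighborFinset x \ {x} = G.neighborFinset x := by
    ext y
    simp only [Finset.mem_sdiff, SimpleGraph.mem_neighborFinset, Finset.mem_singleton,
      and_iff_left_iff_imp]
    exact fun h => h.ne'
  simp only [ham, Finset.sum_singleton, h1, Finset.sum_empty, h2, Function.update_self, zero_div,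
    zero_add, add_left_inj]
  refine Finset.sum_congr rfl fun y hy => ?_
  rw [Function.update_of_ne ((G.mem_neighborFinset _ _).1 hy).ne']

end Hamiltonian
/-- The standing assumptions on the pair interaction `W` and on the single-spin potential `P`. -/
structure IsStable (W : ℝ → ℝ → ℝ) (P : ℝ → ℝ) (I J r a c p q θ : ℝ) : Prop where
  continuous_W : Continuous (Function.uncurry W)
  symm : ∀ u v, W u v = W v u
  abs_W_le : ∀ u v, |W u v| ≤ (I + J * (|u| ^ r + |v| ^ r)) / 2
  continuous_P : Continuous P
  le_P : ∀ u, a * |u| ^ q - c ≤ P u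
  I_pos : 0 < I
  J_pos : 0 < J
  r_pos : 0 < r
  θ_pos : 0 < θ
  a_pos : 0 < a
  c_pos : 0 < c
  le_p : r + r / θ ≤ p
  p_lt_q : p < q

namespace IsStable

variable {W : ℝ → ℝ → ℝ} {P : ℝ → ℝ} {I J r a c p q θ : ℝ}

lemma r_le_p (h : IsStable W P I J r a c p q θ) : r ≤ p := by
  have := div_pos h.r_pos h.θ_pos
  linarith [h.le_p]

lemma p_pos (h : IsStable W P I J r a c p q θ) : 0 < p := h.r_pos.trans_le h.r_le_p

end IsStable

section Partition

variable (G : SimpleGraph V) [∀ v : V, Fintype (G.neighborSet v)] {W : ℝ → ℝ → ℝ} {P : ℝ → ℝ}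
  {I J r a c p q θ : ℝ}

lemma exists_neg_ham_le (h : IsStable W P I J r a c p q θ) (Λ : Finset V) :
    ∃ D A : ℝ, 0 ≤ A ∧ ∀ ω : V → ℝ, -ham G W P Λ ω ≤
      D + J * ∑ x ∈ Λ, ∑ y ∈ G.neighborFinset x \ Λ, |ω y| ^ r
        + ∑ x ∈ Λ, (A * |ω x| ^ p - a * |ω x| ^ q) := by
  obtain ⟨d₁, hd₁⟩ : ∃ d : ℝ, d = ∑ x ∈ Λ, ((G.neighborFinset x ∩ Λ).card : ℝ) := ⟨_, rfl⟩
  obtain ⟨d₂, hd₂⟩ : ∃ d : ℝ, d = ∑ x ∈ Λ, ((G.neighborFinset x \ Λ).card : ℝ) := ⟨_, rfl⟩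
  have hJ := h.J_pos
  have hd₁0 : 0 ≤ d₁ := by
    rw [hd₁]
    exact Finset.sum_nonneg fun _ _ => Nat.cast_nonneg _
  have hd₂0 : 0 ≤ d₂ := by
    rw [hd₂]
    exact Finset.sum_nonneg fun _ _ => Nat.cast_nonneg _
  refine ⟨(d₁ + d₂) * I + J * (2 * d₁ + d₂) * Λ.card + c * Λ.card, J * (2 * d₁ + d₂),
    by positivity, fun ω => ?_⟩
  obtain ⟨T, hT⟩ : ∃ T, T = ∑ z ∈ Λ, |ω z| ^ r := ⟨_, rfl⟩
  have hle : ∀ x ∈ Λ, |ω x| ^ r ≤ T := fun x hx => hT ▸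
    Finset.single_le_sum (f := fun z => |ω z| ^ r) (fun z _ => by positivity) hx
  have hT0 : 0 ≤ T := hT ▸ Finset.sum_nonneg fun z _ => by positivity
  have hW : ∀ u v, -W u v ≤ I + J * (|u| ^ r + |v| ^ r) := fun u v => by
    have h1 := h.abs_W_le u v
    have h2 := neg_abs_le (W u v)
    have : 0 ≤ J * (|u| ^ r + |v| ^ r) := by positivity
    linarith [h.I_pos]
  have e₁ : -∑ x ∈ Λ, ∑ y ∈ G.neighborFinset x ∩ Λ, W (ω x) (ω y) ≤ d₁ * (I + J * (2 * T)) := by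
    rw [hd₁, Finset.sum_mul, ← Finset.sum_neg_distrib]
    refine Finset.sum_le_sum fun x hx => ?_
    rw [← Finset.sum_neg_distrib, ← nsmul_eq_mul]
    refine Finset.sum_le_card_nsmul _ _ _ fun y hy => (hW _ _).trans ?_
    have := hle x hx
    have := hle y (Finset.mem_inter.1 hy).2
    gcongr
    linarith
  have e₂ : -∑ x ∈ Λ, ∑ y ∈ G.neighborFinset x \ Λ, W (ω x) (ω y) ≤
      d₂ * (I + J * T) + J * ∑ x ∈ Λ, ∑ y ∈ G.neighborFinset x \ Λ, |ω y| ^ r := by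
    rw [hd₂, Finset.sum_mul, ← Finset.sum_neg_distrib, Finset.mul_sum, ← Finset.sum_add_distrib]
    refine Finset.sum_le_sum fun x hx => ?_
    rw [← Finset.sum_neg_distrib, ← nsmul_eq_mul, ← Finset.sum_const, Finset.mul_sum,
      ← Finset.sum_add_distrib]
    refine Finset.sum_le_sum fun y _ => (hW _ _).trans ?_
    have := mul_le_mul_of_nonneg_left (hle x hx) hJ.le
    linarith
  have e₃ : -∑ x ∈ Λ, P (ω x) ≤ c * Λ.card - ∑ x ∈ Λ, a * |ω x| ^ q := by
    have := Finset.sum_le_sum fun x (_ : x ∈ Λ) => h.le_P (ω x)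
    rw [Finset.sum_sub_distrib, Finset.sum_const, nsmul_eq_mul] at this
    linarith
  have e₄ : T ≤ Λ.card + ∑ x ∈ Λ, |ω x| ^ p := by
    have := Finset.sum_le_sum fun x (_ : x ∈ Λ) =>
      rpow_le_one_add_rpow h.r_pos.le h.r_le_p (abs_nonneg (ω x))
    rwa [Finset.sum_add_distrib, Finset.sum_const, nsmul_eq_mul, mul_one, ← hT] at this
  have e₅ := mul_le_mul_of_nonneg_left e₄ (show 0 ≤ J * (2 * d₁ + d₂) by positivity)
  have e₆ : 0 ≤ d₁ * (I + J * (2 * T)) := by have := h.I_pos; positivity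
  rw [Finset.sum_sub_distrib, ← Finset.mul_sum]
  unfold ham
  linarith

lemma lintegral_exp_sum_lt_top (hp : 0 < p) (hpq : p < q) (ha : 0 < a) {A : ℝ} (hA : 0 ≤ A)
    (Λ : Finset V) : ∫⁻ σ : ↥Λ → ℝ,
      ENNReal.ofReal (Real.exp (∑ x : ↥Λ, (A * |σ x| ^ p - a * |σ x| ^ q))) < ∞ := by
  have h := Integrable.fintype_prod (𝕜 := ℝ) (ι := ↥Λ) (μ := fun _ => (volume : Measure ℝ))
    (fun _ => integrable_exp_abs_rpow_sub hp hpq hA ha)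
  simp only [← Real.exp_sum] at h
  exact (hasFiniteIntegral_iff_ofReal (ae_of_all _ fun _ => (Real.exp_pos _).le)).1 h.2

lemma sum_comb (f : ℝ → ℝ) (Λ : Finset V) (σ : ↥Λ → ℝ) (ξ : V → ℝ) :
    ∑ x ∈ Λ, f (comb Λ σ ξ x) = ∑ x : ↥Λ, f (σ x) := by
  rw [← Finset.sum_coe_sort]
  exact Finset.sum_congr rfl fun x _ => by rw [comb_apply_of_mem x.2]

lemma sum_outer_comb (f : ℝ → ℝ) (Λ : Finset V) (σ : ↥Λ → ℝ) (ξ : V → ℝ) :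
    ∑ x ∈ Λ, ∑ y ∈ G.neighborFinset x \ Λ, f (comb Λ σ ξ y) =
      ∑ x ∈ Λ, ∑ y ∈ G.neighborFinset x \ Λ, f (ξ y) :=
  Finset.sum_congr rfl fun _ _ => Finset.sum_congr rfl fun _ hy => by
    rw [comb_apply_of_notMem (Finset.mem_sdiff.1 hy).2]

variable (W P) in
/-- The Boltzmann factor `exp (-H_Λ)`. -/
def boltz (Λ : Finset V) (ω : V → ℝ) : ℝ≥0∞ := ENNReal.ofReal (Real.exp (-ham G W P Λ ω))

variable (W P) in
/-- The partition function, as an extended nonnegative real. -/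
def partFun (Λ : Finset V) : (V → ℝ) → ℝ≥0∞ :=
  ∫⋯∫⁻_Λ, boltz G W P Λ ∂fun _ => volume

lemma continuous_boltz (h : IsStable W P I J r a c p q θ) (Λ : Finset V) :
    Continuous (boltz G W P Λ) :=
  ENNReal.continuous_ofReal.comp
    (Real.continuous_exp.comp (continuous_ham G h.continuous_W h.continuous_P Λ).neg)

lemma measurable_boltz (h : IsStable W P I J r a c p q θ) (Λ : Finset V) :
    Measurable (boltz G W P Λ) := (continuous_boltz G h Λ).measurable

lemma exists_boltz_le (h : IsStable W P I J r a c p q θ) (Λ : Finset V) :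
    ∃ D A : ℝ, 0 ≤ A ∧ ∀ (ω : V → ℝ) (σ : ↥Λ → ℝ), boltz G W P Λ (comb Λ σ ω) ≤
      ENNReal.ofReal (Real.exp (D + J * ∑ x ∈ Λ, ∑ y ∈ G.neighborFinset x \ Λ, |ω y| ^ r)) *
        ENNReal.ofReal (Real.exp (∑ x : ↥Λ, (A * |σ x| ^ p - a * |σ x| ^ q))) := by
  obtain ⟨D, A, hA, hDA⟩ := exists_neg_ham_le G h Λ
  refine ⟨D, A, hA, fun ω σ => ?_⟩
  rw [← ENNReal.ofReal_mul (Real.exp_pos _).le, ← Real.exp_add]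
  refine ENNReal.ofReal_le_ofReal (Real.exp_le_exp.2 ((hDA _).trans_eq ?_))
  rw [sum_comb (fun t => A * |t| ^ p - a * |t| ^ q), sum_outer_comb G fun t => |t| ^ r]

lemma lmarginal_rpow_mul_boltz_lt_top (h : IsStable W P I J r a c p q θ) {Λ : Finset V} {x : V}
    (hx : x ∈ Λ) (ξ : V → ℝ) :
    (∫⋯∫⁻_Λ, (fun ω => ENNReal.ofReal (|ω x| ^ p) * boltz G W P Λ ω) ∂fun _ => volume) ξ < ∞ := by
  obtain ⟨D, A, hA, hDA⟩ := exists_boltz_le G h Λ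
  have hfin := lintegral_exp_sum_lt_top h.p_pos h.p_lt_q h.a_pos (add_nonneg hA zero_le_one) Λ
  set B := ENNReal.ofReal
    (Real.exp (D + J * ∑ x ∈ Λ, ∑ y ∈ G.neighborFinset x \ Λ, |ξ y| ^ r)) with hB
  refine lt_of_le_of_lt (lintegral_mono fun σ => ?_)
    ((lintegral_const_mul' B _ ENNReal.ofReal_ne_top).trans_lt
      (ENNReal.mul_lt_top ENNReal.ofReal_lt_top hfin))
  change ENNReal.ofReal (|comb Λ σ ξ x| ^ p) * boltz G W P Λ (comb Λ σ ξ) ≤ _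
  rw [comb_apply_of_mem hx]
  have h1 : |σ ⟨x, hx⟩| ^ p ≤ Real.exp (∑ z : ↥Λ, |σ z| ^ p) := by
    have := Finset.single_le_sum (f := fun z : ↥Λ => |σ z| ^ p) (fun z _ => by positivity)
      (Finset.mem_univ ⟨x, hx⟩)
    linarith [Real.add_one_le_exp (∑ z : ↥Λ, |σ z| ^ p)]
  calc _ ≤ ENNReal.ofReal (Real.exp (∑ z : ↥Λ, |σ z| ^ p)) *
        (B * ENNReal.ofReal (Real.exp (∑ x : ↥Λ, (A * |σ x| ^ p - a * |σ x| ^ q)))) :=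
      mul_le_mul' (ENNReal.ofReal_le_ofReal h1) (hDA ξ σ)
    _ = _ := by
      rw [mul_left_comm, ← ENNReal.ofReal_mul (Real.exp_pos _).le, ← Real.exp_add,
        ← Finset.sum_add_distrib]
      congr 4
      funext z
      ring

lemma partFun_ne_top (h : IsStable W P I J r a c p q θ) (Λ : Finset V) (ξ : V → ℝ) :
    partFun G W P Λ ξ ≠ ∞ := by
  obtain ⟨D, A, hA, hDA⟩ := exists_boltz_le G h Λ
  have hfin := lintegral_exp_sum_lt_top h.p_pos h.p_lt_q h.a_pos hA Λ
  exact (lt_of_le_of_lt (lintegral_mono fun σ => hDA ξ σ)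
    ((lintegral_const_mul' _ _ ENNReal.ofReal_ne_top).trans_lt
      (ENNReal.mul_lt_top ENNReal.ofReal_lt_top hfin))).ne

lemma partFun_ne_zero (h : IsStable W P I J r a c p q θ) (Λ : Finset V) (ξ : V → ℝ) :
    partFun G W P Λ ξ ≠ 0 := by
  have hm : Measurable fun σ : ↥Λ → ℝ => boltz G W P Λ (Function.updateFinset ξ Λ σ) :=
    (measurable_boltz G h Λ).comp measurable_updateFinset
  refine fun h0 => ?_
  have h1 := (lintegral_eq_zero_iff hm).1 h0
  have h2 : ∀ᵐ σ ∂(volume : Measure (↥Λ → ℝ)), False := by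
    filter_upwards [h1] with σ hσ
    exact (ENNReal.ofReal_pos.2 (Real.exp_pos _)).ne' hσ
  rw [ae_iff] at h2
  exact isOpen_univ.measure_ne_zero volume Set.univ_nonempty (by simpa using h2)

lemma continuous_lmarginal_mul_boltz (h : IsStable W P I J r a c p q θ) (Λ : Finset V)
    (f : BoundedContinuousFunction (V → ℝ) ℝ≥0) :
    Continuous (∫⋯∫⁻_Λ, (fun ω => (f ω : ℝ≥0∞) * boltz G W P Λ ω) ∂fun _ => volume) := by
  obtain ⟨D, A, hA, hDA⟩ := exists_boltz_le G h Λ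
  have hfin := lintegral_exp_sum_lt_top h.p_pos h.p_lt_q h.a_pos hA Λ
  have hcont : Continuous fun ω => (f ω : ℝ≥0∞) * boltz G W P Λ ω := by
    have := (f.continuous.mul (continuous_real_toNNReal.comp (Real.continuous_exp.comp
      (continuous_ham G h.continuous_W h.continuous_P Λ).neg)))
    exact (ENNReal.continuous_coe.comp this).congr fun ω => ENNReal.coe_mul _ _
  have hS : Continuous fun ω : V → ℝ => ∑ x ∈ Λ, ∑ y ∈ G.neighborFinset x \ Λ, |ω y| ^ r :=
    continuous_finsetSum _ fun x _ => continuous_finsetSum _ fun y _ =>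
      (continuous_abs_rpow h.r_pos).comp (continuous_apply y)
  refine continuous_iff_continuousAt.2 fun ω₀ => ?_
  set S₀ := ∑ x ∈ Λ, ∑ y ∈ G.neighborFinset x \ Λ, |ω₀ y| ^ r
  have hev : ∀ᶠ ω in nhds ω₀, ∑ x ∈ Λ, ∑ y ∈ G.neighborFinset x \ Λ, |ω y| ^ r < S₀ + 1 :=
    hS.continuousAt.eventually_lt_const (lt_add_one _)
  refine tendsto_lintegral_filter_of_dominated_convergence
    (fun σ => (nndist f 0 : ℝ≥0∞) * (ENNReal.ofReal (Real.exp (D + J * (S₀ + 1))) *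
      ENNReal.ofReal (Real.exp (∑ x : ↥Λ, (A * |σ x| ^ p - a * |σ x| ^ q)))))
    (Eventually.of_forall fun ω => hcont.measurable.comp measurable_updateFinset) ?_ ?_ ?_
  · filter_upwards [hev] with ω hω
    refine ae_of_all _ fun σ => mul_le_mul' ?_ ((hDA ω σ).trans ?_)
    · exact ENNReal.coe_le_coe.2 (BoundedContinuousFunction.NNReal.upper_bound f _)
    · have := h.J_pos
      gcongr
  · rw [lintegral_const_mul' _ _ ENNReal.coe_ne_top,
      lintegral_const_mul' _ _ ENNReal.ofReal_ne_top]
    exact ENNReal.mul_ne_top ENNReal.coe_ne_top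
      (ENNReal.mul_ne_top ENNReal.ofReal_ne_top hfin.ne)
  · exact ae_of_all _ fun σ => (hcont.comp (continuous_comb_right Λ σ)).continuousAt

end Partition
section Specification

variable (G : SimpleGraph V) [∀ v : V, Fintype (G.neighborSet v)] {W : ℝ → ℝ → ℝ} {P : ℝ → ℝ}
  {I J r a c p q θ : ℝ}

lemma ofReal_partZ (h : IsStable W P I J r a c p q θ) (Λ : Finset V) (ξ : V → ℝ) :
    ENNReal.ofReal (partZ G W P Λ ξ) = partFun G W P Λ ξ := by
  refine ofReal_integral_eq_lintegral_ofReal ⟨Measurable.aestronglyMeasurable ?_, ?_⟩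
    (ae_of_all _ fun _ => (Real.exp_pos _).le)
  · exact (Real.continuous_exp.comp
      (continuous_ham G h.continuous_W h.continuous_P Λ).neg).measurable.comp
        (measurable_comb_left Λ ξ)
  · exact (hasFiniteIntegral_iff_ofReal (ae_of_all _ fun _ => (Real.exp_pos _).le)).2
      (partFun_ne_top G h Λ ξ).lt_top

lemma lintegral_gibbsKer (h : IsStable W P I J r a c p q θ) (Λ : Finset V) (ξ : V → ℝ)
    {F : (V → ℝ) → ℝ≥0∞} (hF : Measurable F) :
    ∫⁻ ω, F ω ∂gibbsKer G W P Λ ξ = (partFun G W P Λ ξ)⁻¹ *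
      (∫⋯∫⁻_Λ, (fun ω => F ω * boltz G W P Λ ω) ∂fun _ => volume) ξ := by
  rw [gibbsKer, lintegral_smul_measure, ofReal_partZ G h, smul_eq_mul,
    lintegral_map hF (measurable_comb_left Λ ξ), lintegral_withDensity_eq_lintegral_mul]
  · congr 1
    exact lintegral_congr fun σ => mul_comm _ _
  · exact (measurable_boltz G h Λ).comp (measurable_comb_left Λ ξ)
  · exact hF.comp (measurable_comb_left Λ ξ)

lemma isProbabilityMeasure_gibbsKer (h : IsStable W P I J r a c p q θ) (Λ : Finset V)
    (ξ : V → ℝ) : IsProbabilityMeasure (gibbsKer G W P Λ ξ) := by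
  constructor
  rw [← lintegral_one, lintegral_gibbsKer G h Λ ξ measurable_const]
  simp only [one_mul]
  exact ENNReal.inv_mul_cancel (partFun_ne_zero G h Λ ξ) (partFun_ne_top G h Λ ξ)

lemma measurable_lintegral_gibbsKer (h : IsStable W P I J r a c p q θ) (Λ : Finset V)
    {F : (V → ℝ) → ℝ≥0∞} (hF : Measurable F) :
    Measurable fun ξ => ∫⁻ ω, F ω ∂gibbsKer G W P Λ ξ := by
  simp only [lintegral_gibbsKer G h Λ _ hF]
  exact ((measurable_boltz G h Λ).lmarginal _).inv.mul
    ((hF.mul (measurable_boltz G h Λ)).lmarginal _)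

lemma measurable_gibbsKer (h : IsStable W P I J r a c p q θ) (Λ : Finset V) :
    Measurable (gibbsKer G W P Λ) := by
  refine Measure.measurable_of_measurable_coe _ fun A hA => ?_
  simpa only [lintegral_indicator_one hA] using
    measurable_lintegral_gibbsKer G h Λ (measurable_one.indicator hA)

lemma continuous_lintegral_gibbsKer (h : IsStable W P I J r a c p q θ) (Λ : Finset V)
    (f : BoundedContinuousFunction (V → ℝ) ℝ≥0) :
    Continuous fun ξ => ∫⁻ ω, f ω ∂gibbsKer G W P Λ ξ := by
  simp only [lintegral_gibbsKer G h Λ _ f.continuous.measurable.coe_nnreal_ennreal]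
  have hZ : Continuous (partFun G W P Λ) := by
    simpa [partFun] using continuous_lmarginal_mul_boltz G h Λ 1
  refine continuous_iff_continuousAt.2 fun ξ => ?_
  have hfin : (∫⋯∫⁻_Λ, (fun ω => (f ω : ℝ≥0∞) * boltz G W P Λ ω) ∂fun _ => volume) ξ ≠ ∞ := by
    refine ((lintegral_mono fun σ => mul_le_mul_left (ENNReal.coe_le_coe.2
      (BoundedContinuousFunction.NNReal.upper_bound f _)) _).trans_lt ?_).ne
    rw [lintegral_const_mul' _ _ ENNReal.coe_ne_top]
    exact ENNReal.mul_lt_top ENNReal.coe_lt_top (partFun_ne_top G h Λ ξ).lt_top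
  exact ENNReal.Tendsto.mul (hZ.inv.tendsto ξ)
    (Or.inr hfin) ((continuous_lmarginal_mul_boltz G h Λ f).tendsto ξ)
    (Or.inr (ENNReal.inv_ne_top.2 (partFun_ne_zero G h Λ ξ)))

lemma lintegral_gibbsKer_eq_self (h : IsStable W P I J r a c p q θ) (Λ : Finset V) (ξ : V → ℝ)
    {F : (V → ℝ) → ℝ≥0∞} (hF : Measurable F) (hloc : ∀ ω, (∀ x ∉ Λ, ω x = ξ x) → F ω = F ξ) :
    ∫⁻ ω, F ω ∂gibbsKer G W P Λ ξ = F ξ := by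
  have := isProbabilityMeasure_gibbsKer G h Λ ξ
  have h1 : ∀ σ, F (comb Λ σ ξ) = F ξ := fun σ =>
    hloc _ fun x hx => comb_apply_of_notMem hx σ ξ
  have h2 : ∀ᵐ ω ∂gibbsKer G W P Λ ξ, F ω = F ξ := by
    refine Measure.ae_smul_measure ?_ _
    exact (ae_map_iff (p := fun ω => F ω = F ξ) (measurable_comb_left Λ ξ).aemeasurable
      (hF (measurableSet_singleton _))).2 (ae_of_all _ h1)
  rw [lintegral_congr_ae h2, lintegral_const, measure_univ, mul_one]

lemma lmarginal_mul_of_congr {Δ : Finset V} {g F : (V → ℝ) → ℝ≥0∞}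
    (hg : ∀ ω ω' : V → ℝ, (∀ x ∉ Δ, ω x = ω' x) → g ω = g ω') (hF : Measurable F) (ω : V → ℝ) :
    (∫⋯∫⁻_Δ, (fun ω => g ω * F ω) ∂fun _ => volume) ω =
      g ω * (∫⋯∫⁻_Δ, F ∂fun _ => volume) ω := by
  refine Eq.trans (lintegral_congr fun σ => ?_)
    (lintegral_const_mul (g ω) (hF.comp measurable_updateFinset))
  exact congrArg (· * F (Function.updateFinset ω Δ σ))
    (hg _ _ fun x hx => comb_apply_of_notMem hx σ ω)

/-- Consistency of the local specification: `π_Λ π_Δ = π_Λ` for `Δ ⊆ Λ`. -/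
lemma lintegral_lintegral_gibbsKer (h : IsStable W P I J r a c p q θ) {Δ Λ : Finset V}
    (hΔ : Δ ⊆ Λ) (ξ : V → ℝ) {F : (V → ℝ) → ℝ≥0∞} (hF : Measurable F) :
    ∫⁻ ω, ∫⁻ η, F η ∂gibbsKer G W P Δ ω ∂gibbsKer G W P Λ ξ =
      ∫⁻ ω, F ω ∂gibbsKer G W P Λ ξ := by
  set R : (V → ℝ) → ℝ≥0∞ := fun ω => ENNReal.ofReal (Real.exp (-hamRest G W P Δ Λ ω)) with hR
  have hRB : ∀ ω, boltz G W P Λ ω = R ω * boltz G W P Δ ω := fun ω => by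
    rw [hR, boltz, boltz, ← ENNReal.ofReal_mul (Real.exp_pos _).le, ← Real.exp_add,
      ham_eq_ham_add_hamRest G P h.symm hΔ]
    congr 2
    ring
  have hRc : ∀ ω ω' : V → ℝ, (∀ x ∉ Δ, ω x = ω' x) → R ω = R ω' := fun ω ω' hω => by
    simp only [hR, hamRest_congr G W P hΔ hω]
  have hB := measurable_boltz G h Δ
  have hΦ := measurable_lintegral_gibbsKer G h Δ hF
  rw [lintegral_gibbsKer G h Λ ξ hΦ, lintegral_gibbsKer G h Λ ξ hF]
  have hΛ : Λ = (Λ \ Δ) ∪ Δ := (Finset.sdiff_union_of_subset hΔ).symm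
  suffices H : (∫⋯∫⁻_Δ, (fun ω => (∫⁻ η, F η ∂gibbsKer G W P Δ ω) * boltz G W P Λ ω)
      ∂fun _ => volume) = ∫⋯∫⁻_Δ, (fun ω => F ω * boltz G W P Λ ω) ∂fun _ => volume by
    congr 1
    have key : ∀ f : (V → ℝ) → ℝ≥0∞, Measurable f → (∫⋯∫⁻_Λ, f ∂fun _ => volume) =
        ∫⋯∫⁻_(Λ \ Δ), ∫⋯∫⁻_Δ, f ∂(fun _ => volume) ∂fun _ => (volume : Measure ℝ) := fun f hf => by
      conv_lhs => rw [hΛ]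
      exact lmarginal_union _ f hf Finset.sdiff_disjoint
    rw [key (fun ω => (∫⁻ η, F η ∂gibbsKer G W P Δ ω) * boltz G W P Λ ω)
      (hΦ.mul (measurable_boltz G h Λ)),
      key (fun ω => F ω * boltz G W P Λ ω) (hF.mul (measurable_boltz G h Λ)), H]
  funext ω
  have e₁ : ∀ ω, (∫⁻ η, F η ∂gibbsKer G W P Δ ω) * boltz G W P Λ ω =
      ((∫⁻ η, F η ∂gibbsKer G W P Δ ω) * R ω) * boltz G W P Δ ω := fun ω => by
    rw [hRB, mul_assoc]
  have e₂ : ∀ ω, F ω * boltz G W P Λ ω = R ω * (F ω * boltz G W P Δ ω) := fun ω => by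
    rw [hRB, mul_left_comm]
  simp only [e₁, e₂]
  rw [lmarginal_mul_of_congr _ hB,
    lmarginal_mul_of_congr (F := fun ω => F ω * boltz G W P Δ ω) hRc (hF.mul hB),
    lintegral_gibbsKer G h Δ ω hF]
  · change _ * partFun G W P Δ ω = _
    rw [mul_comm, mul_comm _ (R ω), mul_left_comm, ← mul_assoc (partFun G W P Δ ω),
      ENNReal.mul_inv_cancel (partFun_ne_zero G h Δ ω) (partFun_ne_top G h Δ ω), one_mul]
  · intro ω ω' hω
    rw [hRc ω ω' hω, lintegral_gibbsKer G h Δ ω hF, lintegral_gibbsKer G h Δ ω' hF, partFun,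
      lmarginal_congr _ _ hω, lmarginal_congr _ _ hω]

variable (W P) in
/-- The local Gibbs kernel as a probability measure. -/
def gibbsProb (h : IsStable W P I J r a c p q θ) (Λ : Finset V) (ξ : V → ℝ) :
    ProbabilityMeasure (V → ℝ) :=
  ⟨gibbsKer G W P Λ ξ, isProbabilityMeasure_gibbsKer G h Λ ξ⟩

/-- A weak limit of local Gibbs kernels solves the DLR equation. -/
lemma isGibbsMeasure_of_tendsto (h : IsStable W P I J r a c p q θ) {Λ : ℕ → Finset V}
    (hmono : Monotone Λ) (hex : ∀ x, ∃ n, x ∈ Λ n) {ξ : V → ℝ}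
    (μ : ProbabilityMeasure (V → ℝ))
    (hlim : Tendsto (fun n => gibbsProb G W P h (Λ n) ξ) atTop (nhds μ)) :
    IsGibbsMeasure G W P (μ : Measure (V → ℝ)) := by
  refine ⟨inferInstance, fun Δ A hA => ?_⟩
  rw [← Measure.bind_apply hA (measurable_gibbsKer G h Δ).aemeasurable]
  congr 1
  have hK : ∀ᶠ n in atTop, Δ ⊆ Λ n := by
    choose N hN using hex
    filter_upwards [eventually_ge_atTop (Δ.sup N)] with n hn x hx
    exact hmono ((Finset.le_sup hx).trans hn) (hN x)
  have hT := ProbabilityMeasure.tendsto_iff_forall_lintegral_tendsto.1 hlim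
  have : IsProbabilityMeasure ((μ : Measure (V → ℝ)).bind (gibbsKer G W P Δ)) := by
    have := fun ω => isProbabilityMeasure_gibbsKer G h Δ ω
    constructor
    rw [Measure.bind_apply MeasurableSet.univ (measurable_gibbsKer G h Δ).aemeasurable]
    simp
  refine ext_of_forall_lintegral_eq_of_IsFiniteMeasure fun f => ?_
  have hf : Measurable fun ω => (f ω : ℝ≥0∞) := f.continuous.measurable.coe_nnreal_ennreal
  rw [Measure.lintegral_bind (measurable_gibbsKer G h Δ).aemeasurable hf.aemeasurable]
  have hle : ∀ ω, ∫⁻ η, f η ∂gibbsKer G W P Δ ω ≤ (nndist f 0 : ℝ≥0∞) := fun ω => by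
    have := isProbabilityMeasure_gibbsKer G h Δ ω
    refine (lintegral_mono fun η => ENNReal.coe_le_coe.2
      (BoundedContinuousFunction.NNReal.upper_bound f η)).trans_eq ?_
    simp
  have hne : ∀ ω, ∫⁻ η, f η ∂gibbsKer G W P Δ ω ≠ ∞ := fun ω =>
    ((hle ω).trans_lt ENNReal.coe_lt_top).ne
  let g : BoundedContinuousFunction (V → ℝ) ℝ≥0 := BoundedContinuousFunction.mkOfBound
    ⟨fun ω => (∫⁻ η, f η ∂gibbsKer G W P Δ ω).toNNReal,
      continuous_iff_continuousAt.2 fun ω => (ENNReal.tendsto_toNNReal (hne ω)).comp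
        (continuous_lintegral_gibbsKer G h Δ f).continuousAt⟩ (nndist f 0 : ℝ) (fun ω ω' => by
      have hb : ∀ ω, (∫⁻ η, f η ∂gibbsKer G W P Δ ω).toNNReal ≤ nndist f 0 := fun ω =>
        ENNReal.toNNReal_mono ENNReal.coe_ne_top (hle ω)
      rw [NNReal.dist_eq]
      have h1 := NNReal.coe_le_coe.2 (hb ω)
      have h2 := NNReal.coe_le_coe.2 (hb ω')
      exact abs_sub_le_of_nonneg_of_le (NNReal.coe_nonneg _) h1 (NNReal.coe_nonneg _) h2)
  have hg : ∀ ω, (g ω : ℝ≥0∞) = ∫⁻ η, f η ∂gibbsKer G W P Δ ω := fun ω =>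
    ENNReal.coe_toNNReal (hne ω)
  have hTg := hT g
  simp only [hg] at hTg
  refine tendsto_nhds_unique (hT f) (hTg.congr' ?_)
  filter_upwards [hK] with n hn
  exact lintegral_lintegral_gibbsKer G h hn ξ hf

end Specification

section SingleSite

/-- An exponential Chebyshev bound for the `p`-th moment of the density `exp (-H)`. -/
lemma lintegral_rpow_mul_exp_neg_le {p q a A B : ℝ} (hp : 0 < p) (hpq : p < q) (ha : 0 < a)
    {H : ℝ → ℝ} (hH : Measurable H)
    (hA : ∀ t, |t| ^ p - H t ≤ A + (2 * |t| ^ p - a * |t| ^ q))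
    (hB : ∀ t ∈ Set.Icc (0 : ℝ) 1, H t ≤ B) :
    ∫⁻ t, ENNReal.ofReal (|t| ^ p) * ENNReal.ofReal (Real.exp (-H t)) ≤
      (ENNReal.ofReal ((∫ t : ℝ, Real.exp (2 * |t| ^ p - a * |t| ^ q)) + A + B) + 1) *
        ∫⁻ t, ENNReal.ofReal (Real.exp (-H t)) := by
  have hint := integrable_exp_abs_rpow_sub hp hpq zero_le_two ha
  obtain ⟨K, hK⟩ : ∃ K, K = ∫ t : ℝ, Real.exp (2 * |t| ^ p - a * |t| ^ q) := ⟨_, rfl⟩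
  rw [← hK]
  have hKl : ∫⁻ t : ℝ, ENNReal.ofReal (Real.exp (2 * |t| ^ p - a * |t| ^ q)) =
      ENNReal.ofReal K := by
    rw [hK, ofReal_integral_eq_lintegral_ofReal hint (ae_of_all _ fun _ => (Real.exp_pos _).le)]
  have hm : Measurable fun t => ENNReal.ofReal (Real.exp (-H t)) :=
    (Real.measurable_exp.comp hH.neg).ennreal_ofReal
  have hZ : ENNReal.ofReal (Real.exp (-B)) ≤ ∫⁻ t, ENNReal.ofReal (Real.exp (-H t)) := by
    calc ENNReal.ofReal (Real.exp (-B))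
        = ∫⁻ _ in Set.Icc (0 : ℝ) 1, ENNReal.ofReal (Real.exp (-B)) := by simp
      _ ≤ ∫⁻ t in Set.Icc (0 : ℝ) 1, ENNReal.ofReal (Real.exp (-H t)) := by
        refine setLIntegral_mono hm fun t ht => ENNReal.ofReal_le_ofReal (Real.exp_le_exp.2 ?_)
        linarith [hB t ht]
      _ ≤ _ := setLIntegral_le_lintegral _ _
  have hpt : ∀ t, ENNReal.ofReal (|t| ^ p) * ENNReal.ofReal (Real.exp (-H t)) ≤
      ENNReal.ofReal (K + A + B) * ENNReal.ofReal (Real.exp (-H t)) +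
        ENNReal.ofReal (Real.exp (-K - B)) *
          ENNReal.ofReal (Real.exp (2 * |t| ^ p - a * |t| ^ q)) := fun t => by
    have h1 : |t| ^ p ≤ (K + A + B) + Real.exp (|t| ^ p - (K + A + B)) := by
      linarith [Real.add_one_le_exp (|t| ^ p - (K + A + B))]
    calc _ ≤ (ENNReal.ofReal (K + A + B) + ENNReal.ofReal (Real.exp (|t| ^ p - (K + A + B)))) *
          ENNReal.ofReal (Real.exp (-H t)) := by
          gcongr
          exact (ENNReal.ofReal_le_ofReal h1).trans ENNReal.ofReal_add_le
      _ ≤ _ := by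
        rw [add_mul, ← ENNReal.ofReal_mul (Real.exp_pos (_ - _)).le,
          ← ENNReal.ofReal_mul (Real.exp_pos (_ - _)).le, ← Real.exp_add, ← Real.exp_add]
        refine add_le_add le_rfl (ENNReal.ofReal_le_ofReal (Real.exp_le_exp.2 ?_))
        linarith [hA t]
  calc _ ≤ _ := lintegral_mono hpt
    _ = ENNReal.ofReal (K + A + B) * (∫⁻ t, ENNReal.ofReal (Real.exp (-H t))) +
        ENNReal.ofReal (Real.exp (-K - B)) * ENNReal.ofReal K := by
      rw [lintegral_add_left (hm.const_mul _), lintegral_const_mul' _ _ ENNReal.ofReal_ne_top,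
        lintegral_const_mul' _ _ ENNReal.ofReal_ne_top, hKl]
    _ ≤ _ := by
      rw [add_mul, one_mul]
      gcongr
      refine le_trans ?_ hZ
      rw [← ENNReal.ofReal_mul (Real.exp_pos _).le]
      refine ENNReal.ofReal_le_ofReal ?_
      rw [show -B = (-K - B) + K by ring, Real.exp_add (-K - B) K]
      gcongr
      linarith [Real.add_one_le_exp K]

variable (G : SimpleGraph V) [∀ v : V, Fintype (G.neighborSet v)]

/-- The vertex quantity `m_θ(x) = ∑_{y ∼ x} (n(x) n(y))^θ`. -/
def degWeight (θ : ℝ) (x : V) : ℝ :=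
  ∑ y ∈ G.neighborFinset x, ((G.degree x : ℝ) * (G.degree y : ℝ)) ^ θ

lemma degWeight_nonneg (θ : ℝ) (x : V) : 0 ≤ degWeight G θ x :=
  Finset.sum_nonneg fun _ _ => by positivity

lemma one_le_degree_of_mem {x y : V} (hy : y ∈ G.neighborFinset x) :
    (1 : ℝ) ≤ G.degree x ∧ (1 : ℝ) ≤ G.degree y := by
  rw [SimpleGraph.mem_neighborFinset] at hy
  exact ⟨Nat.one_le_cast.2 (G.degree_pos_iff_exists_adj x |>.2 ⟨y, hy⟩),
    Nat.one_le_cast.2 (G.degree_pos_iff_exists_adj y |>.2 ⟨x, hy.symm⟩)⟩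

lemma degree_mul_rpow_le_degWeight {θ : ℝ} (hθ : 0 < θ) (x : V) :
    (G.degree x : ℝ) * (G.degree x : ℝ) ^ θ ≤ degWeight G θ x := by
  conv_lhs => rw [← G.card_neighborFinset_eq_degree x, ← nsmul_eq_mul, ← Finset.sum_const]
  refine Finset.sum_le_sum fun y hy => ?_
  have := one_le_degree_of_mem G hy
  rw [G.card_neighborFinset_eq_degree x]
  refine Real.rpow_le_rpow (by linarith) ?_ hθ.le
  nlinarith

lemma degree_le_degWeight {θ : ℝ} (hθ : 0 < θ) (x : V) :
    (G.degree x : ℝ) ≤ degWeight G θ x := by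
  refine le_trans ?_ (degree_mul_rpow_le_degWeight G hθ x)
  rcases Nat.eq_zero_or_pos (G.degree x) with h0 | h0
  · simp [h0]
  · have := Real.one_le_rpow (Nat.one_le_cast (α := ℝ) |>.2 h0) hθ.le
    nlinarith [Nat.cast_nonneg (α := ℝ) (G.degree x)]

lemma sum_degree_rpow_le_degWeight {θ : ℝ} (hθ : 0 < θ) (x : V) :
    ∑ y ∈ G.neighborFinset x, (G.degree y : ℝ) ^ θ ≤ degWeight G θ x := by
  refine Finset.sum_le_sum fun y hy => Real.rpow_le_rpow (Nat.cast_nonneg _) ?_ hθ.le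
  have := one_le_degree_of_mem G hy
  nlinarith

variable {W : ℝ → ℝ → ℝ} {P : ℝ → ℝ} {I J r a c p q θ : ℝ}

/-- The single-site moment bound. -/
lemma exists_lintegral_gibbsKer_singleton_le (h : IsStable W P I J r a c p q θ) {η : ℝ}
    (hη : 0 < η) : ∃ C : ℝ, 0 ≤ C ∧ ∀ (x : V) (ξ : V → ℝ),
      ∫⁻ ω, ENNReal.ofReal (|ω x| ^ p) ∂gibbsKer G W P {x} ξ ≤
        ENNReal.ofReal (C * (1 + degWeight G θ x)) + ∑ y ∈ G.neighborFinset x,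
          ENNReal.ofReal (η / G.degree y) * ENNReal.ofReal (|ξ y| ^ p) := by
  have hI := h.I_pos
  have hJ := h.J_pos
  have hc := h.c_pos
  obtain ⟨C₁, hC₁, hY₁⟩ := exists_mul_rpow_le_div_add h.r_pos h.θ_pos h.le_p hJ.le one_pos
  obtain ⟨C₂, hC₂, hY₂⟩ := exists_mul_rpow_le_div_add h.r_pos h.θ_pos h.le_p
    (mul_pos two_pos hJ).le hη
  obtain ⟨M, hM⟩ := (isCompact_Icc (a := (0 : ℝ)) (b := 1)).exists_bound_of_continuousOn
    h.continuous_P.continuousOn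
  have hM0 : 0 ≤ M := (norm_nonneg _).trans (hM 0 (by simp))
  obtain ⟨K, hK⟩ : ∃ K, K = ∫ t : ℝ, Real.exp (2 * |t| ^ p - a * |t| ^ q) := ⟨_, rfl⟩
  have hK0 : 0 ≤ K := hK ▸ integral_nonneg fun _ => (Real.exp_pos _).le
  refine ⟨K + c + M + 1 + 2 * I + J + C₁ + C₂, by positivity, fun x ξ => ?_⟩
  obtain ⟨H, hH⟩ : ∃ H : ℝ → ℝ, H = fun t => ∑ y ∈ G.neighborFinset x, W t (ξ y) + P t := ⟨_, rfl⟩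
  obtain ⟨n, hn⟩ : ∃ n : ℝ, n = G.degree x := ⟨_, rfl⟩
  have hn0 : 0 ≤ n := hn ▸ Nat.cast_nonneg _
  obtain ⟨S, hS⟩ : ∃ S, S = ∑ y ∈ G.neighborFinset x, |ξ y| ^ r := ⟨_, rfl⟩
  have hS0 : 0 ≤ S := hS ▸ Finset.sum_nonneg fun y _ => by positivity
  have hHm : Measurable H := by
    rw [hH]
    refine Continuous.measurable (Continuous.add (continuous_finsetSum _ fun y _ => ?_)
      h.continuous_P)
    exact h.continuous_W.comp (continuous_id.prodMk continuous_const)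
  have hWs : ∀ t, |∑ y ∈ G.neighborFinset x, W t (ξ y)| ≤ n * I + n * (J * |t| ^ r) + J * S := by
    intro t
    refine (Finset.abs_sum_le_sum_abs _ _).trans ?_
    rw [hS, Finset.mul_sum, ← mul_add, hn, ← G.card_neighborFinset_eq_degree x, ← nsmul_eq_mul,
      ← Finset.sum_const, ← Finset.sum_add_distrib]
    refine Finset.sum_le_sum fun y _ => (h.abs_W_le _ _).trans ?_
    have : 0 ≤ J * (|t| ^ r + |ξ y| ^ r) := by positivity
    linarith
  have hY : ∀ t : ℝ, n * (J * |t| ^ r) ≤ |t| ^ p + C₁ * (n * n ^ θ) := by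
    intro t
    rcases Nat.eq_zero_or_pos (G.degree x) with h0 | h0
    · rw [hn, h0]
      simp only [Nat.cast_zero, zero_mul, mul_zero, add_zero]
      positivity
    · have hn1 : 1 ≤ n := hn ▸ Nat.one_le_cast.2 h0
      have := mul_le_mul_of_nonneg_left (hY₁ n |t| hn1 (abs_nonneg t)) hn0
      refine this.trans_eq ?_
      field_simp
  have hmom := lintegral_rpow_mul_exp_neg_le h.p_pos h.p_lt_q h.a_pos hHm
    (A := n * I + C₁ * (n * n ^ θ) + J * S + c) (B := n * I + n * J + J * S + M)
    (fun t => by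
      have h1 := (neg_abs_le _).trans' (neg_le_neg (hWs t))
      have h2 := h.le_P t
      have h3 := hY t
      rw [hH]
      dsimp only
      linarith)
    (fun t ht => by
      have h1 := (le_abs_self _).trans (hWs t)
      have h2 := (le_abs_self _).trans (hM t ht)
      have h3 : |t| ^ r ≤ 1 := Real.rpow_le_one (abs_nonneg t)
        (abs_le.2 ⟨by linarith [ht.1], ht.2⟩) h.r_pos.le
      have h4 : n * (J * |t| ^ r) ≤ n * J := by
        refine mul_le_mul_of_nonneg_left ?_ hn0
        nlinarith
      rw [hH]
      dsimp only
      linarith)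
  rw [← hK] at hmom
  have hb : ∀ t, boltz G W P {x} (Function.update ξ x t) = ENNReal.ofReal (Real.exp (-H t)) :=
    fun t => by rw [boltz, ham_singleton_update, hH]
  have hx : Measurable fun ω : V → ℝ => ENNReal.ofReal (|ω x| ^ p) :=
    ((continuous_abs_rpow h.p_pos).measurable.comp (measurable_pi_apply x)).ennreal_ofReal
  have hZ : partFun G W P {x} ξ = ∫⁻ t, ENNReal.ofReal (Real.exp (-H t)) := by
    rw [partFun, lmarginal_singleton]
    exact lintegral_congr hb
  have hle : ∫⁻ ω, ENNReal.ofReal (|ω x| ^ p) ∂gibbsKer G W P {x} ξ ≤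
      ENNReal.ofReal (K + (n * I + C₁ * (n * n ^ θ) + J * S + c) +
        (n * I + n * J + J * S + M)) + 1 := by
    rw [lintegral_gibbsKer G h _ _ hx, lmarginal_singleton]
    simp only [hb, Function.update_self]
    refine (mul_le_mul_right hmom _).trans_eq ?_
    rw [← hZ, mul_left_comm, ENNReal.inv_mul_cancel (partFun_ne_zero G h _ _)
      (partFun_ne_top G h _ _), mul_one]
  refine hle.trans ?_
  have hsum : ∑ y ∈ G.neighborFinset x, ENNReal.ofReal (η / G.degree y) *
      ENNReal.ofReal (|ξ y| ^ p) =
      ENNReal.ofReal (∑ y ∈ G.neighborFinset x, η * |ξ y| ^ p / G.degree y) := by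
    rw [ENNReal.ofReal_sum_of_nonneg fun y _ => by positivity]
    refine Finset.sum_congr rfl fun y _ => ?_
    rw [← ENNReal.ofReal_mul (by positivity), div_mul_eq_mul_div]
  have hm0 := degWeight_nonneg G θ x
  have hsum0 : 0 ≤ ∑ y ∈ G.neighborFinset x, η * |ξ y| ^ p / G.degree y :=
    Finset.sum_nonneg fun y _ => by positivity
  rw [hsum, ← ENNReal.ofReal_add (by positivity) hsum0, ← ENNReal.ofReal_one,
    ← ENNReal.ofReal_add (by positivity) zero_le_one]
  refine ENNReal.ofReal_le_ofReal ?_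
  have h2S : 2 * J * S ≤ ∑ y ∈ G.neighborFinset x, η * |ξ y| ^ p / G.degree y +
      C₂ * degWeight G θ x := by
    have h1 : 2 * J * S ≤ ∑ y ∈ G.neighborFinset x,
        (η * |ξ y| ^ p / G.degree y + C₂ * (G.degree y : ℝ) ^ θ) := by
      rw [hS, Finset.mul_sum]
      exact Finset.sum_le_sum fun y hy => hY₂ _ _ (one_le_degree_of_mem G hy).2 (abs_nonneg _)
    rw [Finset.sum_add_distrib, ← Finset.mul_sum] at h1
    have := mul_le_mul_of_nonneg_left (sum_degree_rpow_le_degWeight G h.θ_pos x) hC₂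
    linarith
  have hn1 : n ≤ degWeight G θ x := hn ▸ degree_le_degWeight G h.θ_pos x
  have hn2 : n * n ^ θ ≤ degWeight G θ x := hn ▸ degree_mul_rpow_le_degWeight G h.θ_pos x
  have e1 := mul_le_mul_of_nonneg_right hn1 hI.le
  have e2 := mul_le_mul_of_nonneg_right hn1 hJ.le
  have e3 := mul_le_mul_of_nonneg_left hn2 hC₁
  have e4 : 0 ≤ (K + c + M + 1) * degWeight G θ x := by positivity
  nlinarith

end SingleSite

section Global

variable (G : SimpleGraph V) [∀ v : V, Fintype (G.neighborSet v)]

lemma wgt_le_mul_wgt_of_adj (hconn : G.Connected) (o : V) (α : ℝ) {x y : V} (hxy : G.Adj x y) :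
    wgt G o α x ≤ Real.exp |α| * wgt G o α y := by
  rw [wgt, wgt, ← Real.exp_add]
  refine Real.exp_le_exp.2 ?_
  have h1 : G.dist x y = 1 := SimpleGraph.dist_eq_one_iff_adj.2 hxy
  have h2 : (G.dist o y : ℝ) ≤ G.dist o x + 1 := by
    have := hconn.dist_triangle (u := o) (v := x) (w := y)
    rw [h1] at this
    exact_mod_cast this
  have h3 : (G.dist o x : ℝ) ≤ G.dist o y + 1 := by
    have := hconn.dist_triangle (u := o) (v := y) (w := x)
    rw [SimpleGraph.dist_comm (u := y), h1] at this
    exact_mod_cast this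
  have h4 : |(G.dist o y : ℝ) - G.dist o x| ≤ 1 := abs_le.2 ⟨by linarith, by linarith⟩
  have h5 : α * ((G.dist o y : ℝ) - G.dist o x) ≤ |α| := by
    refine (le_abs_self _).trans ?_
    rw [abs_mul]
    exact mul_le_of_le_one_right (abs_nonneg α) h4
  linarith

/-- Double counting along edges. -/
lemma tsum_sum_neighborFinset_comm (f : V → V → ℝ≥0∞) :
    ∑' x, ∑ y ∈ G.neighborFinset x, f x y = ∑' y, ∑ x ∈ G.neighborFinset y, f x y := by
  rw [tsum_congr fun x => sum_eq_tsum_indicator (f x) (G.neighborFinset x), ENNReal.tsum_comm,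
    tsum_congr fun y => sum_eq_tsum_indicator (fun x => f x y) (G.neighborFinset y)]
  refine tsum_congr fun y => tsum_congr fun x => ?_
  have hxy := G.adj_comm x y
  by_cases hx : G.Adj x y
  · simp [Set.indicator, hx, hxy.1 hx]
  · simp [Set.indicator, hx, mt hxy.2 hx]

/-- A weighted Gronwall-type bound: a subsolution with finite weighted mass is controlled by
the source term. -/
lemma tsum_mul_le_of_le_add_sum_neighborFinset (hconn : G.Connected) (o : V) (α : ℝ)
    {u b : V → ℝ≥0∞} (hu : ∑' x, ENNReal.ofReal (wgt G o α x) * u x ≠ ∞)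
    (hub : ∀ x, u x ≤ b x + ∑ y ∈ G.neighborFinset x,
      ENNReal.ofReal (Real.exp (-|α|) / 2 / G.degree y) * u y) :
    ∑' x, ENNReal.ofReal (wgt G o α x) * u x ≤
      2 * ∑' x, ENNReal.ofReal (wgt G o α x) * b x := by
  obtain ⟨S, hS⟩ : ∃ S, S = ∑' x, ENNReal.ofReal (wgt G o α x) * u x := ⟨_, rfl⟩
  obtain ⟨B, hB⟩ : ∃ B, B = ∑' x, ENNReal.ofReal (wgt G o α x) * b x := ⟨_, rfl⟩
  have hnbr : ∀ y, ∑ x ∈ G.neighborFinset y, ENNReal.ofReal (wgt G o α x) *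
      (ENNReal.ofReal (Real.exp (-|α|) / 2 / G.degree y) * u y) ≤
      ENNReal.ofReal (wgt G o α y) * u y * 2⁻¹ := by
    intro y
    calc _ ≤ ∑ x ∈ G.neighborFinset y, ENNReal.ofReal (Real.exp |α| * wgt G o α y) *
          (ENNReal.ofReal (Real.exp (-|α|) / 2 / G.degree y) * u y) := by
          refine Finset.sum_le_sum fun x hx => mul_le_mul_left (ENNReal.ofReal_le_ofReal ?_) _
          exact wgt_le_mul_wgt_of_adj G hconn o α ((G.mem_neighborFinset _ _).1 hx).symm
      _ = ENNReal.ofReal (G.degree y * (Real.exp |α| * wgt G o α y *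
          (Real.exp (-|α|) / 2 / G.degree y))) * u y := by
          have hw : 0 ≤ Real.exp |α| * wgt G o α y :=
            mul_nonneg (Real.exp_pos _).le (Real.exp_pos _).le
          rw [Finset.sum_const, G.card_neighborFinset_eq_degree, nsmul_eq_mul,
            ENNReal.ofReal_mul (Nat.cast_nonneg _), ENNReal.ofReal_mul hw, ENNReal.ofReal_natCast]
          ring
      _ ≤ ENNReal.ofReal (wgt G o α y * 2⁻¹) * u y := by
          refine mul_le_mul_left (ENNReal.ofReal_le_ofReal ?_) _
          rcases Nat.eq_zero_or_pos (G.degree y) with h0 | h0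
          · rw [h0, Nat.cast_zero, zero_mul]
            exact mul_nonneg (Real.exp_pos _).le (by norm_num)
          · have hn : (0 : ℝ) < G.degree y := Nat.cast_pos.2 h0
            refine le_of_eq ?_
            rw [Real.exp_neg]
            have := (Real.exp_pos |α|).ne'
            field_simp
      _ = _ := by
          rw [ENNReal.ofReal_mul (show 0 ≤ wgt G o α y from (Real.exp_pos _).le),
            ENNReal.ofReal_inv_of_pos two_pos,
            ENNReal.ofReal_ofNat, mul_right_comm]
  have h1 : S ≤ B + S * 2⁻¹ := by
    calc S ≤ ∑' x, (ENNReal.ofReal (wgt G o α x) * b x + ∑ y ∈ G.neighborFinset x,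
          ENNReal.ofReal (wgt G o α x) *
            (ENNReal.ofReal (Real.exp (-|α|) / 2 / G.degree y) * u y)) := by
          rw [hS]
          refine ENNReal.tsum_le_tsum fun x => ?_
          rw [← Finset.mul_sum, ← mul_add]
          exact mul_le_mul_right (hub x) _
      _ ≤ _ := by
          rw [ENNReal.tsum_add, tsum_sum_neighborFinset_comm, ← hB, hS, ← ENNReal.tsum_mul_right]
          gcongr with y
          exact hnbr y
  rw [← hS] at hu
  rw [← hS, ← hB]
  have hS2 : S * 2⁻¹ ≠ ∞ := ENNReal.mul_ne_top hu (by simp)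
  have h2 : S * 2⁻¹ + S * 2⁻¹ = S := by rw [← mul_add, ENNReal.inv_two_add_inv_two, mul_one]
  have h3 : S * 2⁻¹ ≤ B := by
    rw [← h2, h2, add_comm] at h1
    nth_rewrite 1 [← h2] at h1
    exact (ENNReal.add_le_add_iff_left hS2).1 h1
  calc S = 2 * (S * 2⁻¹) := by rw [two_mul, h2]
    _ ≤ _ := by gcongr

lemma summable_one_add_degWeight_mul_wgt (hconn : G.Connected) (o : V) {α θ : ℝ} (hθ : 0 < θ)
    (hΘ : ThetaFin G o α θ) :
    Summable fun x => (1 + degWeight G θ x) * wgt G o α x := by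
  rcases subsingleton_or_nontrivial V with hV | hV
  · exact Summable.of_finite
  · refine Summable.of_nonneg_of_le (fun x => mul_nonneg (by linarith [degWeight_nonneg G θ x])
      (Real.exp_pos _).le) (fun x => ?_) (Summable.mul_left 2 hΘ)
    have h1 : (1 : ℝ) ≤ G.degree x :=
      Nat.one_le_cast.2 (hconn.preconnected.degree_pos_of_nontrivial x)
    have h2 := degree_le_degWeight G hθ x
    change _ ≤ 2 * (degWeight G θ x * wgt G o α x)
    rw [← mul_assoc]
    exact mul_le_mul_of_nonneg_right (by linarith) (Real.exp_pos _).le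

variable {W : ℝ → ℝ → ℝ} {P : ℝ → ℝ} {I J r a c p q θ : ℝ}

lemma measurable_ofReal_abs_rpow (hp : 0 < p) (x : V) :
    Measurable fun ω : V → ℝ => ENNReal.ofReal (|ω x| ^ p) :=
  ((continuous_abs_rpow hp).measurable.comp (measurable_pi_apply x)).ennreal_ofReal

/-- The weighted moments of the local Gibbs kernels are bounded uniformly in the volume. -/
lemma exists_tsum_lintegral_gibbsKer_le (h : IsStable W P I J r a c p q θ) (hconn : G.Connected)
    {o : V} {α : ℝ} (hΘ : ThetaFin G o α θ) {ξ : V → ℝ} (hξ : ξ ∈ tempered G o p α) :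
    ∃ K : ℝ≥0∞, K ≠ ∞ ∧ ∀ Λ : Finset V, ∑' x, ENNReal.ofReal (wgt G o α x) *
      ∫⁻ ω, ENNReal.ofReal (|ω x| ^ p) ∂gibbsKer G W P Λ ξ ≤ K := by
  obtain ⟨C, hC, hCx⟩ := exists_lintegral_gibbsKer_singleton_le G h
    (show 0 < Real.exp (-|α|) / 2 by positivity)
  have hm := measurable_ofReal_abs_rpow (V := V) h.p_pos
  have hw : ∀ x, 0 ≤ wgt G o α x := fun x => (Real.exp_pos _).le
  have hsumξ : ∑' x, ENNReal.ofReal (wgt G o α x) * ENNReal.ofReal (|ξ x| ^ p) ≠ ∞ := by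
    simp only [← ENNReal.ofReal_mul (hw _), mul_comm (wgt G o α _)]
    exact Summable.tsum_ofReal_ne_top hξ
  have hsumC : ∑' x, ENNReal.ofReal (wgt G o α x) *
      ENNReal.ofReal (C * (1 + degWeight G θ x)) ≠ ∞ := by
    simp only [← ENNReal.ofReal_mul (hw _), mul_left_comm (wgt G o α _) C,
      mul_comm (wgt G o α _)]
    exact ((summable_one_add_degWeight_mul_wgt G hconn o h.θ_pos hΘ).mul_left C).tsum_ofReal_ne_top
  refine ⟨2 * ∑' x, ENNReal.ofReal (wgt G o α x) *
    (ENNReal.ofReal (|ξ x| ^ p) + ENNReal.ofReal (C * (1 + degWeight G θ x))), ?_, fun Λ => ?_⟩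
  · rw [tsum_congr fun x => mul_add _ _ _, ENNReal.tsum_add]
    exact ENNReal.mul_ne_top ENNReal.ofNat_ne_top (ENNReal.add_ne_top.2 ⟨hsumξ, hsumC⟩)
  have hoff : ∀ x ∉ Λ, ∫⁻ ω, ENNReal.ofReal (|ω x| ^ p) ∂gibbsKer G W P Λ ξ =
      ENNReal.ofReal (|ξ x| ^ p) := fun x hx =>
    lintegral_gibbsKer_eq_self G h Λ ξ (hm x) fun ω hω => by rw [hω x hx]
  have hon : ∀ x ∈ Λ, ∫⁻ ω, ENNReal.ofReal (|ω x| ^ p) ∂gibbsKer G W P Λ ξ ≠ ∞ := fun x hx => by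
    rw [lintegral_gibbsKer G h Λ ξ (hm x)]
    exact ENNReal.mul_ne_top (ENNReal.inv_ne_top.2 (partFun_ne_zero G h Λ ξ))
      (lmarginal_rpow_mul_boltz_lt_top G h hx ξ).ne
  refine tsum_mul_le_of_le_add_sum_neighborFinset G hconn o α ?_ fun x => ?_
  · have hle : ∑' x, ENNReal.ofReal (wgt G o α x) *
        ∫⁻ ω, ENNReal.ofReal (|ω x| ^ p) ∂gibbsKer G W P Λ ξ ≤
        ∑' x, ENNReal.ofReal (wgt G o α x) * ENNReal.ofReal (|ξ x| ^ p) +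
        ∑ x ∈ Λ, ENNReal.ofReal (wgt G o α x) *
          ∫⁻ ω, ENNReal.ofReal (|ω x| ^ p) ∂gibbsKer G W P Λ ξ := by
      rw [sum_eq_tsum_indicator, ← ENNReal.tsum_add]
      refine ENNReal.tsum_le_tsum fun x => ?_
      by_cases hx : x ∈ Λ
      · simp [Set.indicator, hx]
      · rw [hoff x hx]
        exact le_self_add
    refine ne_top_of_le_ne_top (ENNReal.add_ne_top.2 ⟨hsumξ, ?_⟩) hle
    exact ENNReal.sum_ne_top.2 fun x hx => ENNReal.mul_ne_top ENNReal.ofReal_ne_top (hon x hx)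
  · by_cases hx : x ∈ Λ
    · rw [← lintegral_lintegral_gibbsKer G h (Finset.singleton_subset_iff.2 hx) ξ (hm x)]
      refine (lintegral_mono fun ω => hCx x ω).trans ?_
      have := isProbabilityMeasure_gibbsKer G h Λ ξ
      rw [lintegral_add_left measurable_const, lintegral_const, measure_univ, mul_one,
        lintegral_finsetSum _ fun y _ => (hm y).const_mul _]
      simp only [lintegral_const_mul' _ _ ENNReal.ofReal_ne_top]
      gcongr
      exact le_add_self
    · rw [hoff x hx]
      exact le_self_add.trans le_self_add

end Global

section Limits

variable {p : ℝ}

/-- Uniform coordinatewise moment bounds imply tightness on the product space `ℝ^V`. -/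
lemma isTightMeasureSet_of_lintegral_rpow_le (hp : 0 < p) {S : Set (Measure (V → ℝ))}
    (k : V → ℝ≥0) (hk : ∀ μ ∈ S, ∀ x, ∫⁻ ω, ENNReal.ofReal (|ω x| ^ p) ∂μ ≤ k x) :
    IsTightMeasureSet S := by
  refine isTightMeasureSet_iff_exists_isCompact_measure_compl_le.2 fun ε hε => ?_
  obtain ⟨δ, hδ, hδε⟩ := ENNReal.exists_pos_sum_of_countable hε.ne' V
  let M : V → ℝ≥0 := fun x => k x / δ x + 1
  refine ⟨Set.pi Set.univ fun x => Set.Icc (-(M x : ℝ) ^ p⁻¹) ((M x : ℝ) ^ p⁻¹),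
    isCompact_univ_pi fun x => isCompact_Icc, fun μ hμ => ?_⟩
  have hsub : (Set.pi Set.univ fun x => Set.Icc (-(M x : ℝ) ^ p⁻¹) ((M x : ℝ) ^ p⁻¹))ᶜ ⊆
      ⋃ x, {ω : V → ℝ | (M x : ℝ≥0∞) ≤ ENNReal.ofReal (|ω x| ^ p)} := by
    intro ω hω
    simp only [Set.mem_compl_iff, Set.mem_pi, Set.mem_univ, true_implies, not_forall] at hω
    obtain ⟨x, hx⟩ := hω
    refine Set.mem_iUnion.2 ⟨x, ?_⟩
    have hlt : (M x : ℝ) ^ p⁻¹ < |ω x| := by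
      by_contra hle
      exact hx (abs_le.1 (not_lt.1 hle))
    have h1 := Real.rpow_le_rpow (by positivity) hlt.le hp.le
    rw [Real.rpow_inv_rpow (M x).coe_nonneg hp.ne'] at h1
    change (M x : ℝ≥0∞) ≤ _
    rw [← ENNReal.ofReal_coe_nnreal]
    exact ENNReal.ofReal_le_ofReal h1
  refine (measure_mono hsub).trans ((measure_iUnion_le _).trans
    ((ENNReal.tsum_le_tsum fun x => ?_).trans hδε.le))
  have hMpos : M x ≠ 0 := by positivity
  have h1 := (mul_meas_ge_le_lintegral (μ := μ) (measurable_ofReal_abs_rpow hp x)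
    (M x : ℝ≥0∞)).trans (hk μ hμ x)
  have h2 : (k x : ℝ≥0∞) ≤ M x * δ x := by
    rw [← ENNReal.coe_mul]
    refine ENNReal.coe_le_coe.2 ?_
    rw [add_mul, div_mul_cancel₀ _ (hδ x).ne']
    exact le_self_add
  exact (ENNReal.mul_le_mul_iff_right (ENNReal.coe_ne_zero.2 hMpos) ENNReal.coe_ne_top).1
    (h1.trans h2)

lemma tsum_lintegral_le_of_tendsto (hp : 0 < p) {w : V → ℝ} (hw : ∀ x, 0 ≤ w x)
    {ν : ℕ → ProbabilityMeasure (V → ℝ)} {μ : ProbabilityMeasure (V → ℝ)}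
    (hlim : Tendsto ν atTop (nhds μ)) {K : ℝ≥0∞}
    (hK : ∀ n, ∑' x, ENNReal.ofReal (w x) *
      ∫⁻ ω, ENNReal.ofReal (|ω x| ^ p) ∂(ν n : Measure (V → ℝ)) ≤ K) :
    ∑' x, ENNReal.ofReal (w x) *
      ∫⁻ ω, ENNReal.ofReal (|ω x| ^ p) ∂(μ : Measure (V → ℝ)) ≤ K := by
  rw [ENNReal.tsum_eq_iSup_sum]
  refine iSup_le fun F => ?_
  have hF : ∀ ρ : Measure (V → ℝ), ∫⁻ ω, ENNReal.ofReal (∑ x ∈ F, w x * |ω x| ^ p) ∂ρ =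
      ∑ x ∈ F, ENNReal.ofReal (w x) * ∫⁻ ω, ENNReal.ofReal (|ω x| ^ p) ∂ρ := by
    intro ρ
    have h1 : ∀ ω : V → ℝ, ENNReal.ofReal (∑ x ∈ F, w x * |ω x| ^ p) =
        ∑ x ∈ F, ENNReal.ofReal (w x) * ENNReal.ofReal (|ω x| ^ p) := fun ω => by
      rw [ENNReal.ofReal_sum_of_nonneg fun x _ => mul_nonneg (hw x) (by positivity)]
      exact Finset.sum_congr rfl fun x _ => ENNReal.ofReal_mul (hw x)
    simp only [h1]
    rw [lintegral_finsetSum _ fun x _ => (measurable_ofReal_abs_rpow hp x).const_mul _]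
    exact Finset.sum_congr rfl fun x _ => lintegral_const_mul' _ _ ENNReal.ofReal_ne_top
  rw [← hF]
  refine (lintegral_le_liminf_lintegral_of_forall_isOpen_measure_le_liminf_measure
    (continuous_finsetSum _ fun x _ => continuous_const.mul
      ((continuous_abs_rpow hp).comp (continuous_apply x)))
    (fun ω => Finset.sum_nonneg fun x _ =>
      mul_nonneg (hw x) (Real.rpow_nonneg (abs_nonneg (ω x)) p))
    fun U hU => ProbabilityMeasure.le_liminf_measure_open_of_tendsto hlim hU).trans ?_
  refine (liminf_le_liminf (v := fun _ => K) (Eventually.of_forall fun n => ?_)).trans_eq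
    (liminf_const K)
  change ∫⁻ ω, ENNReal.ofReal (∑ x ∈ F, w x * |ω x| ^ p) ∂(ν n : Measure (V → ℝ)) ≤ K
  rw [hF]
  exact (ENNReal.sum_le_tsum F).trans (hK n)

lemma ae_mem_tempered_of_tsum_lintegral_ne_top (G : SimpleGraph V) (o : V) {α : ℝ} (hp : 0 < p)
    {μ : Measure (V → ℝ)} (hμ : ∑' x, ENNReal.ofReal (wgt G o α x) *
      ∫⁻ ω, ENNReal.ofReal (|ω x| ^ p) ∂μ ≠ ∞) :
    ∀ᵐ ω ∂μ, ω ∈ tempered G o p α := by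
  have hm : ∀ x, Measurable fun ω : V → ℝ =>
      ENNReal.ofReal (wgt G o α x) * ENNReal.ofReal (|ω x| ^ p) := fun x =>
    (measurable_ofReal_abs_rpow hp x).const_mul _
  have h1 : ∫⁻ ω, ∑' x, ENNReal.ofReal (wgt G o α x) * ENNReal.ofReal (|ω x| ^ p) ∂μ ≠ ∞ := by
    rw [lintegral_tsum fun x => (hm x).aemeasurable]
    simpa only [lintegral_const_mul' _ _ ENNReal.ofReal_ne_top] using hμ
  filter_upwards [ae_lt_top (Measurable.tsum hm) h1] with ω hω
  refine (ENNReal.summable_toReal hω.ne).congr fun x => ?_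
  rw [ENNReal.toReal_mul, ENNReal.toReal_ofReal (show 0 ≤ wgt G o α x from (Real.exp_pos _).le),
    ENNReal.toReal_ofReal (by positivity), mul_comm]

lemma exists_monotone_exhausting [Nonempty V] :
    ∃ Λ : ℕ → Finset V, Monotone Λ ∧ ∀ x, ∃ n, x ∈ Λ n := by
  obtain ⟨e, he⟩ := exists_surjective_nat V
  refine ⟨fun n => (Finset.range (n + 1)).image e, fun m n hmn =>
    Finset.image_subset_image (Finset.range_mono (by lia)), fun x => ?_⟩
  obtain ⟨n, rfl⟩ := he x
  exact ⟨n, Finset.mem_image_of_mem e (Finset.self_mem_range_succ n)⟩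

variable (G : SimpleGraph V) [∀ v : V, Fintype (G.neighborSet v)] {W : ℝ → ℝ → ℝ} {P : ℝ → ℝ}
  {I J r a c q θ : ℝ}

/-- Along some increasing exhausting sequence of volumes, the local Gibbs kernels converge. -/
lemma exists_tendsto_gibbsProb (h : IsStable W P I J r a c p q θ) (hconn : G.Connected)
    {o : V} {α : ℝ} (hΘ : ThetaFin G o α θ) {ξ : V → ℝ} (hξ : ξ ∈ tempered G o p α) :
    ∃ (Λ : ℕ → Finset V) (μ : ProbabilityMeasure (V → ℝ)), Monotone Λ ∧ (∀ x, ∃ n, x ∈ Λ n) ∧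
      Tendsto (fun n => gibbsProb G W P h (Λ n) ξ) atTop (nhds μ) := by
  obtain ⟨K, hK, hKΛ⟩ := exists_tsum_lintegral_gibbsKer_le G h hconn hΘ hξ
  have := hconn.nonempty
  obtain ⟨Λ, hmono, hex⟩ := exists_monotone_exhausting (V := V)
  have hw : ∀ x, ENNReal.ofReal (wgt G o α x) ≠ 0 := fun x =>
    (ENNReal.ofReal_pos.2 (Real.exp_pos _)).ne'
  have htight : IsTightMeasureSet {((μ : ProbabilityMeasure (V → ℝ)) : Measure (V → ℝ)) |
      μ ∈ Set.range fun n => gibbsProb G W P h (Λ n) ξ} := by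
    refine isTightMeasureSet_of_lintegral_rpow_le h.p_pos
      (fun x => (K / ENNReal.ofReal (wgt G o α x)).toNNReal) ?_
    rintro _ ⟨_, ⟨n, rfl⟩, rfl⟩ x
    rw [ENNReal.coe_toNNReal (ENNReal.div_ne_top hK (hw x)),
      ENNReal.le_div_iff_mul_le (Or.inl (hw x)) (Or.inl ENNReal.ofReal_ne_top), mul_comm]
    exact (ENNReal.le_tsum x).trans (hKΛ (Λ n))
  obtain ⟨μ, -, φ, hφ, hlim⟩ := (isCompact_closure_of_isTightMeasureSet htight).tendsto_subseq
    fun n => subset_closure (Set.mem_range_self n)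
  refine ⟨Λ ∘ φ, μ, hmono.comp hφ.monotone, fun x => ?_, hlim⟩
  obtain ⟨n, hn⟩ := hex x
  exact ⟨n, hmono hφ.le_apply hn⟩

/-- Weak limits of the local Gibbs kernels are tempered Gibbs measures. -/
lemma isGibbsMeasure_and_tempered_of_tendsto (h : IsStable W P I J r a c p q θ)
    (hconn : G.Connected) {o : V} {α : ℝ} (hΘ : ThetaFin G o α θ) {ξ : V → ℝ}
    (hξ : ξ ∈ tempered G o p α) {Λ : ℕ → Finset V} (hmono : Monotone Λ)
    (hex : ∀ x, ∃ n, x ∈ Λ n) {μ : ProbabilityMeasure (V → ℝ)}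
    (hlim : Tendsto (fun n => gibbsProb G W P h (Λ n) ξ) atTop (nhds μ)) :
    IsGibbsMeasure G W P (μ : Measure (V → ℝ)) ∧
      (μ : Measure (V → ℝ)) (tempered G o p α) = 1 := by
  refine ⟨isGibbsMeasure_of_tendsto G h hmono hex μ hlim, ?_⟩
  obtain ⟨K, hK, hKΛ⟩ := exists_tsum_lintegral_gibbsKer_le G h hconn hΘ hξ
  have h1 := tsum_lintegral_le_of_tendsto h.p_pos (w := wgt G o α)
    (fun x => (Real.exp_pos _).le) hlim (fun n => hKΛ (Λ n))
  have h2 := ae_mem_tempered_of_tsum_lintegral_ne_top G o h.p_pos (ne_top_of_le_ne_top hK h1)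
  exact (measure_congr (eventuallyEq_univ.2 h2)).trans measure_univ

end Limits

end TemperedGibbs

/-- **Existence of tempered Gibbs measures (Corollary).** Fix `p ∈ [p₀,q)` and
`α ∈ (α_,ᾱ]`. For every `ξ ∈ L^p(V,w_α)` there is an increasing sequence of finite sets
`Λ_n` exhausting `V` such that `π_{Λ_n}(·|ξ)` converges weakly to a probability measure
`μ`; every such weak limit solves the DLR equation and satisfies `μ(L^p(V,w_α)) = 1`.
In particular, `𝒢_{p,α} ≠ ∅`. -/
theorem existence_of_tempered_gibbs_measures
    (G : SimpleGraph V) [∀ v : V, Fintype (G.neighborSet v)] (hconn : G.Connected)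
    (o : V) (θ : ℝ) (hθ : 0 < θ)
    (αlow αbar : ℝ) (hαlow : αlow = sInf {α : ℝ | ThetaFin G o α θ})
    (hbar : αlow < αbar) (hΘ : ∀ α ∈ Set.Ioc αlow αbar, ThetaFin G o α θ)
    (W : ℝ → ℝ → ℝ) (hWcont : Continuous (Function.uncurry W))
    (hWsym : ∀ u v : ℝ, W u v = W v u)
    (IW JW r : ℝ) (hIW : 0 < IW) (hJW : 0 < JW) (hr : 0 < r)
    (hW : ∀ u v : ℝ, |W u v| ≤ (IW + JW * (|u| ^ r + |v| ^ r)) / 2)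
    (P : ℝ → ℝ) (hPcont : Continuous P)
    (aV cV q : ℝ) (haV : 0 < aV) (hcV : 0 < cV) (hq : r + r / θ < q)
    (hP : ∀ u : ℝ, aV * |u| ^ q - cV ≤ P u)
    (p α : ℝ) (hp : p ∈ Set.Ico (r + r / θ) q) (hα : α ∈ Set.Ioc αlow αbar)
    (ξ : V → ℝ) (hξ : ξ ∈ tempered G o p α) :
    (∃ (Λ : ℕ → Finset V) (μ : Measure (V → ℝ)), Monotone Λ ∧ (∀ x : V, ∃ n, x ∈ Λ n) ∧
      IsProbabilityMeasure μ ∧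
      ∀ f : BoundedContinuousFunction (V → ℝ) ℝ,
        Filter.Tendsto (fun n => ∫ ω, f ω ∂(gibbsKer G W P (Λ n) ξ))
          Filter.atTop (nhds (∫ ω, f ω ∂μ))) ∧
    (∀ (Λ : ℕ → Finset V) (μ : Measure (V → ℝ)), Monotone Λ → (∀ x : V, ∃ n, x ∈ Λ n) →
      IsProbabilityMeasure μ →
      (∀ f : BoundedContinuousFunction (V → ℝ) ℝ,
        Filter.Tendsto (fun n => ∫ ω, f ω ∂(gibbsKer G W P (Λ n) ξ))
          Filter.atTop (nhds (∫ ω, f ω ∂μ))) →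
      IsGibbsMeasure G W P μ ∧ μ (tempered G o p α) = 1) ∧
    (∃ μ : Measure (V → ℝ), IsGibbsMeasure G W P μ ∧ μ (tempered G o p α) = 1) := by
  have h : TemperedGibbs.IsStable W P IW JW r aV cV p q θ :=
    ⟨hWcont, hWsym, hW, hPcont, hP, hIW, hJW, hr, hθ, haV, hcV, hp.1, hp.2⟩
  obtain ⟨Λ, μ, hmono, hex, hlim⟩ :=
    TemperedGibbs.exists_tendsto_gibbsProb G h hconn (hΘ α hα) hξ
  refine ⟨⟨Λ, μ, hmono, hex, inferInstance,
    ProbabilityMeasure.tendsto_iff_forall_integral_tendsto.1 hlim⟩, ?_, μ,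
    TemperedGibbs.isGibbsMeasure_and_tempered_of_tendsto G h hconn (hΘ α hα) hξ hmono hex hlim⟩
  intro Λ' μ' hmono' hex' hμ' hlim'
  exact TemperedGibbs.isGibbsMeasure_and_tempered_of_tendsto G h hconn (hΘ α hα) hξ hmono' hex'
    (μ := ⟨μ', hμ'⟩) (ProbabilityMeasure.tendsto_iff_forall_integral_tendsto.2 hlim')
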